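/- arXiv:0708.2321 — 2 statements merged into one kernel-verified Lean document; each statement's English description precedes it below -/
import Mathlib

section
/- Suppose the distribution P of (X,Y) satisfies the margin assumption (MA) with parameters α ≥ 0, C₀ > 0. Then there exists a constant C > 0 depending only on α and C₀ such that for every decision rule f, P_X(f(X) ≠ f**(X,f)) ≤ C d(f)^{α/(1+α)}, where d(f) = R(f) − R(f*) and f**(x,f) equals f*(x) if η(x) ≠ 1/2 and equals f(x) if η(x) = 1/2. -/
open MeasureTheory ENNReal Matrix
open scoped Classical

noncomputable section

abbrev Euc (d : ℕ) := EuclideanSpace ℝ (Fin d)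

/-- Margin (low noise) assumption (MA) with parameters `α`, `C₀`:
`P_X(0 < |η(X) − 1/2| ≤ t) ≤ C₀ t^α` for all `t > 0`. -/
def margin (d : ℕ) (α C₀ : ℝ) (PX : Measure (Euc d)) (η : Euc d → ℝ) : Prop :=
  ∀ t : ℝ, 0 < t →
    PX {x | 0 < |η x - 1/2| ∧ |η x - 1/2| ≤ t} ≤ ENNReal.ofReal (C₀ * t ^ α)

/-- The plug-in rule `1{η ≥ 1/2}`; applied to the true regression function this is
the Bayes rule `f*`. -/
def plugin (d : ℕ) (η : Euc d → ℝ) : Euc d → Bool :=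
  fun x => if 1/2 ≤ η x then true else false

/-- Excess risk `R(f) − R(f*) = E[|2η(X)−1| 1{f(X) ≠ f*(X)}]`. -/
def excessRisk (d : ℕ) (PX : Measure (Euc d)) (η : Euc d → ℝ) (f : Euc d → Bool) : ℝ :=
  ∫ x, (if f x = plugin d η x then 0 else |2 * η x - 1|) ∂PX

/-- Joint distribution `P` of `(X,Y)` on `ℝ^d × ℝ` (with `Y ∈ {0,1}`) determined by the
marginal `PX` of `X` and the regression function `η(x) = P(Y = 1 | X = x)`. -/
def joint (d : ℕ) (PX : Measure (Euc d)) (η : Euc d → ℝ) : Measure (Euc d × ℝ) :=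
  PX.bind fun x =>
    ENNReal.ofReal (η x) • Measure.dirac (x, (1:ℝ)) +
      ENNReal.ofReal (1 - η x) • Measure.dirac (x, (0:ℝ))

/-- Law `P^⊗n` of the i.i.d. sample `(X₁,Y₁),…,(Xₙ,Yₙ)`. -/
def sampleLaw (d n : ℕ) (PX : Measure (Euc d)) (η : Euc d → ℝ) :
    Measure (Fin n → Euc d × ℝ) :=
  Measure.pi fun _ => joint d PX η

/-- Expected excess risk `E[R(f̂ₙ)] − R(f*)` of a classifier `f̂ₙ`. -/
def expectedExcess (d n : ℕ) (PX : Measure (Euc d)) (η : Euc d → ℝ)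
    (fhat : (Fin n → Euc d × ℝ) → Euc d → Bool) : ℝ :=
  ∫ D, excessRisk d PX η (fhat D) ∂(sampleLaw d n PX η)

theorem excessRisk_nonneg (d : ℕ) (PX : Measure (Euc d)) (η : Euc d → ℝ) (f : Euc d → Bool) :
    0 ≤ excessRisk d PX η f :=
  integral_nonneg fun x => by
    show (0 : ℝ) ≤ if f x = plugin d η x then 0 else |2 * η x - 1|
    split_ifs <;> positivity

theorem measurable_plugin {d : ℕ} {η : Euc d → ℝ} (hη : Measurable η) :
    Measurable (plugin d η) :=
  Measurable.ite (measurableSet_le measurable_const hη) measurable_const measurable_const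

theorem integrable_excessRisk_integrand {d : ℕ} {PX : Measure (Euc d)} [IsFiniteMeasure PX]
    {η : Euc d → ℝ} (hη : Measurable η) (hη01 : ∀ x, η x ∈ Set.Icc (0 : ℝ) 1)
    {f : Euc d → Bool} (hf : Measurable f) :
    Integrable (fun x => if f x = plugin d η x then 0 else |2 * η x - 1|) PX := by
  refine Integrable.of_bound (C := 1) (Measurable.aestronglyMeasurable ?_) (.of_forall fun x => ?_)
  · exact Measurable.ite (measurableSet_eq_fun hf (measurable_plugin hη)) measurable_const
      ((hη.const_mul 2).sub_const 1).abs
  · obtain ⟨h0, h1⟩ := hη01 x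
    split_ifs
    · simp
    · rw [Real.norm_eq_abs, abs_abs, abs_le]
      constructor <;> linarith

/-- Splitting the disagreement set at the level `t` of `|η - 1/2|`: the margin assumption
controls the part below `t`, and Markov's inequality the part above. -/
theorem measure_disagreement_le {d : ℕ} {α C₀ : ℝ} (hC₀ : 0 ≤ C₀) {PX : Measure (Euc d)}
    [IsFiniteMeasure PX] {η : Euc d → ℝ} (hη : Measurable η)
    (hη01 : ∀ x, η x ∈ Set.Icc (0 : ℝ) 1) (hm : margin d α C₀ PX η)
    {f : Euc d → Bool} (hf : Measurable f) {t : ℝ} (ht : 0 < t) :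
    PX {x | f x ≠ (if η x = 1/2 then f x else plugin d η x)} ≤
      ENNReal.ofReal (C₀ * t ^ α + excessRisk d PX η f / (2 * t)) := by
  have hsub : {x | f x ≠ (if η x = 1/2 then f x else plugin d η x)} ⊆
      {x | 0 < |η x - 1/2| ∧ |η x - 1/2| ≤ t} ∪
        {x | 2 * t ≤ if f x = plugin d η x then 0 else |2 * η x - 1|} := by
    intro x hx
    by_cases h : η x = 1/2
    · simp [h] at hx
    · simp only [Set.mem_ofPred_eq, if_neg h] at hx
      rcases le_or_gt |η x - 1/2| t with hle | hgt
      · exact Or.inl ⟨abs_pos.mpr (sub_ne_zero.mpr h), hle⟩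
      · right
        have h2 : |2 * η x - 1| = 2 * |η x - 1/2| := by
          rw [show 2 * η x - 1 = 2 * (η x - 1/2) by ring, abs_mul, abs_two]
        simp only [Set.mem_ofPred_eq, if_neg hx, h2]
        linarith
  have hmarkov : PX {x | 2 * t ≤ if f x = plugin d η x then 0 else |2 * η x - 1|} ≤
      ENNReal.ofReal (excessRisk d PX η f / (2 * t)) := by
    have h := mul_meas_ge_le_integral_of_nonneg
      (.of_forall fun x => by
        show (0 : ℝ) ≤ if f x = plugin d η x then 0 else |2 * η x - 1|
        split_ifs <;> positivity)
      (integrable_excessRisk_integrand (PX := PX) hη hη01 hf) (2 * t)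
    rw [← ofReal_measureReal]
    refine ENNReal.ofReal_le_ofReal ?_
    rw [le_div_iff₀' (by positivity)]
    exact h
  rw [ENNReal.ofReal_add (by positivity)
    (div_nonneg (excessRisk_nonneg d PX η f) (by positivity))]
  exact (measure_mono hsub).trans
    ((measure_union_le _ _).trans (add_le_add (hm t ht) hmarkov))

theorem statement15 (d : ℕ) (α C₀ : ℝ) (hα : 0 ≤ α) (hC₀ : 0 < C₀) :
    ∃ C > (0:ℝ), ∀ (PX : Measure (Euc d)) (η : Euc d → ℝ), IsProbabilityMeasure PX →
      Measurable η → (∀ x, η x ∈ Set.Icc (0:ℝ) 1) → margin d α C₀ PX η →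
      ∀ f : Euc d → Bool, Measurable f →
        PX {x | f x ≠ (if η x = 1/2 then f x else plugin d η x)} ≤
          ENNReal.ofReal (C * excessRisk d PX η f ^ (α / (1 + α))) := by
  refine ⟨C₀ + 1, by positivity, fun PX η _ hη hη01 hm f hf => ?_⟩
  have key := fun t ht => measure_disagreement_le hC₀.le hη hη01 hm hf (t := t) ht
  have he := excessRisk_nonneg d PX η f
  set e := excessRisk d PX η f
  have hα1 : 0 < 1 + α := by linarith
  rcases hα.eq_or_lt with rfl | hαpos
  · refine prob_le_one.trans ?_
    rw [← ENNReal.ofReal_one]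
    refine ENNReal.ofReal_le_ofReal ?_
    simp [hC₀.le]
  rcases he.eq_or_lt with he0 | hepos
  · have hlim : Filter.Tendsto (fun t : ℝ => ENNReal.ofReal (C₀ * t ^ α))
        (nhdsWithin 0 (Set.Ioi 0)) (nhds 0) := by
      have h : Filter.Tendsto (fun t : ℝ => C₀ * t ^ α) (nhds 0) (nhds (C₀ * 0 ^ α)) :=
        ((Real.continuousAt_rpow_const 0 α (Or.inr hα)).tendsto).const_mul C₀
      rw [Real.zero_rpow hαpos.ne', mul_zero] at h
      simpa using ENNReal.tendsto_ofReal (h.mono_left nhdsWithin_le_nhds)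
    refine (ge_of_tendsto hlim ?_).trans zero_le
    filter_upwards [self_mem_nhdsWithin] with t ht
    simpa [← he0] using key t ht
  · refine (key (e ^ (1 / (1 + α))) (Real.rpow_pos_of_pos hepos _)).trans
      (ENNReal.ofReal_le_ofReal ?_)
    have h1 : (e ^ (1 / (1 + α))) ^ α = e ^ (α / (1 + α)) := by
      rw [← Real.rpow_mul he, one_div_mul_eq_div]
    have h2 : e / e ^ (1 / (1 + α)) = e ^ (α / (1 + α)) := by
      rw [show α / (1 + α) = 1 - 1 / (1 + α) by field_simp; ring, Real.rpow_sub hepos,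
        Real.rpow_one]
    have h3 := Real.rpow_nonneg he (α / (1 + α))
    rw [h1, mul_comm 2, ← div_div, h2]
    linarith
end
end

section
/- Let P be a distribution of (X,Y) satisfying the margin assumption (MA) with parameters α ≥ 0, C₀ > 0, and let η̂_n be an estimator such that for some C₁, C₂ > 0, a_n > 0, all δ' > 0 and P_X-almost all x, P^⊗n(|η̂_n(x) − η(x)| ≥ δ') ≤ C₁ exp(−C₂ a_n δ'²). Let f̂_n = 1{η̂_n ≥ 1/2}. Then for every δ > 0 and every integer j ≥ 1, E[|2η(X) − 1| 1{f̂_n(X) ≠ f*(X)} 1{2^{j−1}δ < |η(X) − 1/2| ≤ 2^j δ}] ≤ 2 C₁ C₀ 2^{j(1+α)} δ^{1+α} exp(−C₂ a_n (2^{j−1}δ)²), the expectation being taken jointly over the sample and X ∼ P_X. -/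
open MeasureTheory ENNReal Matrix
open scoped Classical

noncomputable section

lemma measurable_joint_kernel (d : ℕ) {η : Euc d → ℝ} (hη : Measurable η) :
    Measurable fun x : Euc d =>
      ENNReal.ofReal (η x) • Measure.dirac (x, (1:ℝ)) +
        ENNReal.ofReal (1 - η x) • Measure.dirac (x, (0:ℝ)) := by
  refine Measure.measurable_of_measurable_coe _ fun s hs => ?_
  simp only [Measure.add_apply, Measure.smul_apply, smul_eq_mul, Measure.dirac_apply' _ hs]
  have h (c : ℝ) : Measurable fun x : Euc d => s.indicator (1 : Euc d × ℝ → ℝ≥0∞) (x, c) :=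
    (measurable_one.indicator hs).comp (measurable_id.prodMk measurable_const)
  exact (hη.ennreal_ofReal.mul (h 1)).add ((hη.const_sub 1).ennreal_ofReal.mul (h 0))

lemma isProbabilityMeasure_joint (d : ℕ) (PX : Measure (Euc d)) [IsProbabilityMeasure PX]
    {η : Euc d → ℝ} (hη : Measurable η) (hrange : ∀ x, η x ∈ Set.Icc (0:ℝ) 1) :
    IsProbabilityMeasure (joint d PX η) := by
  refine ⟨?_⟩
  rw [joint, Measure.bind_apply MeasurableSet.univ (measurable_joint_kernel d hη).aemeasurable]
  have h (x : Euc d) : ENNReal.ofReal (η x) + ENNReal.ofReal (1 - η x) = 1 := by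
    rw [← ENNReal.ofReal_add (hrange x).1 (sub_nonneg.2 (hrange x).2)]
    simp
  simp [h]

/-- If the plug-in rules of `f` and `g` disagree at `x`, then `f x` is at least as far from `g x`
as the threshold `1/2` is. -/
lemma abs_sub_half_le_of_plugin_ne {d : ℕ} {f g : Euc d → ℝ} {x : Euc d}
    (h : plugin d f x ≠ plugin d g x) : |g x - 1/2| ≤ |f x - g x| := by
  unfold plugin at h
  by_cases hf : 1/2 ≤ f x <;> by_cases hg : 1/2 ≤ g x
  · exact absurd (by simp only [hf, hg]) h
  · rw [abs_of_nonpos (by linarith), abs_of_nonneg (by linarith)]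
    linarith
  · rw [abs_of_nonneg (by linarith), abs_of_nonpos (by linarith)]
    linarith
  · exact absurd (by simp only [hf, hg]) h

/-- The mass of a measurable set of the product is at most the essential bound on its sections
times the mass of the base set over which it lies. -/
lemma measure_prod_le_of_sections {β γ : Type*} [MeasurableSpace β] [MeasurableSpace γ]
    (μ : Measure β) (ν : Measure γ) [SFinite μ] [SFinite ν] {S : Set (β × γ)} {A : Set γ}
    (hS : MeasurableSet S) (hA : MeasurableSet A) (hSA : ∀ q ∈ S, q.2 ∈ A) {K : ℝ≥0∞}
    (hK : ∀ᵐ x ∂ν, μ {y | (y, x) ∈ S} ≤ K) : μ.prod ν S ≤ K * ν A := by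
  rw [Measure.prod_apply_symm hS, ← lintegral_indicator_const hA]
  refine lintegral_mono_ae ?_
  filter_upwards [hK] with x hx
  by_cases hxA : x ∈ A
  · rw [Set.indicator_of_mem hxA]
    exact hx
  · have : (fun y => (y, x)) ⁻¹' S = ∅ :=
      Set.eq_empty_of_forall_notMem fun y hy => hxA (hSA _ hy)
    simp [this]

theorem statement18 (d n : ℕ) (hn : 1 ≤ n) (α C₀ C₁ C₂ an : ℝ)
    (hα : 0 ≤ α) (hC₀ : 0 < C₀) (hC₁ : 0 < C₁) (hC₂ : 0 < C₂) (han : 0 < an)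
    (PX : Measure (Euc d)) (η : Euc d → ℝ) (hprob : IsProbabilityMeasure PX)
    (hmeas : Measurable η) (hrange : ∀ x, η x ∈ Set.Icc (0:ℝ) 1)
    (hMA : margin d α C₀ PX η)
    (ηhat : (Fin n → Euc d × ℝ) → Euc d → ℝ)
    (hhat : Measurable (Function.uncurry ηhat))
    (hexp : ∀ δ' : ℝ, 0 < δ' → ∀ᵐ x ∂PX,
      sampleLaw d n PX η {D | δ' ≤ |ηhat D x - η x|} ≤
        ENNReal.ofReal (C₁ * Real.exp (-(C₂ * an * δ' ^ 2))))
    (δ : ℝ) (hδ : 0 < δ) (j : ℕ) (hj : 1 ≤ j) :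
    (∫ q, (if 2 ^ (j - 1) * δ < |η q.2 - 1/2| ∧ |η q.2 - 1/2| ≤ 2 ^ j * δ then
        (if plugin d (ηhat q.1) q.2 = plugin d η q.2 then 0 else |2 * η q.2 - 1|) else 0)
      ∂((sampleLaw d n PX η).prod PX)) ≤
      2 * C₁ * C₀ * 2 ^ ((j : ℝ) * (1 + α)) * δ ^ (1 + α) *
        Real.exp (-(C₂ * an * (2 ^ (j - 1) * δ) ^ 2)) := by
  have := isProbabilityMeasure_joint d PX hmeas hrange
  have : IsProbabilityMeasure (sampleLaw d n PX η) := by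
    unfold sampleLaw
    infer_instance
  set t : ℝ := 2 ^ (j - 1) * δ with ht_def
  set r : ℝ := 2 ^ j * δ with hr_def
  have ht : 0 < t := by positivity
  have hr : 0 < r := by positivity
  set A : Set (Euc d) := {x | 0 < |η x - 1/2| ∧ |η x - 1/2| ≤ r} with hA_def
  set S : Set ((Fin n → Euc d × ℝ) × Euc d) :=
    {q | q.2 ∈ A ∧ t ≤ |ηhat q.1 q.2 - η q.2|} with hS_def
  have hA : MeasurableSet A := by
    have h : Measurable fun x => |η x - 1/2| := (hmeas.sub_const _).abs
    exact (measurableSet_lt measurable_const h).inter (measurableSet_le h measurable_const)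
  have hS : MeasurableSet S :=
    (measurable_snd hA).inter
      (measurableSet_le measurable_const (hhat.sub (hmeas.comp measurable_snd)).abs)
  set K : ℝ := C₁ * Real.exp (-(C₂ * an * t ^ 2)) with hK_def
  have hK : 0 ≤ K := by positivity
  have hmass : (sampleLaw d n PX η).prod PX S ≤ ENNReal.ofReal (K * (C₀ * r ^ α)) := by
    rw [ENNReal.ofReal_mul hK]
    refine (measure_prod_le_of_sections _ _ hS hA (fun q hq => hq.1) ?_).trans
      (mul_le_mul_right (hMA r hr) _)
    filter_upwards [hexp t ht] with x hx
    exact (measure_mono fun D hD => hD.2).trans hx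
  have hreal : ((sampleLaw d n PX η).prod PX).real S ≤ K * (C₀ * r ^ α) :=
    ENNReal.toReal_le_of_le_ofReal (by positivity) hmass
  calc _ ≤ ∫ q, S.indicator (fun _ => 2 * r) q ∂((sampleLaw d n PX η).prod PX) := by
        refine integral_mono_of_nonneg (Filter.Eventually.of_forall fun q => ?_)
          ((integrable_const _).indicator hS) (Filter.Eventually.of_forall fun q => ?_)
        · simp only [Pi.zero_apply]
          split_ifs <;> positivity
        · have hnn : 0 ≤ S.indicator (fun _ => 2 * r) q :=
            Set.indicator_nonneg (fun _ _ => by positivity) q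
          dsimp only
          split_ifs with hq hne
          · exact hnn
          · have hqS : q ∈ S :=
              ⟨⟨ht.trans hq.1, hq.2⟩, hq.1.le.trans (abs_sub_half_le_of_plugin_ne hne)⟩
            rw [Set.indicator_of_mem hqS, show 2 * η q.2 - 1 = 2 * (η q.2 - 1/2) by ring,
              abs_mul, abs_two]
            linarith [hq.2]
          · exact hnn
    _ = ((sampleLaw d n PX η).prod PX).real S * (2 * r) := by
        rw [integral_indicator_const _ hS, smul_eq_mul]
    _ ≤ K * (C₀ * r ^ α) * (2 * r) := by gcongr
    _ = _ := by
        have hpow : r * r ^ α = 2 ^ ((j : ℝ) * (1 + α)) * δ ^ (1 + α) := by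
          rw [← Real.rpow_one_add' hr.le (by positivity), hr_def,
            Real.mul_rpow (by positivity) hδ.le, Real.rpow_mul (by norm_num),
            Real.rpow_natCast]
        rw [hK_def]
        linear_combination 2 * C₁ * C₀ * Real.exp (-(C₂ * an * t ^ 2)) * hpow
end
end
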